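/- arXiv:2406.16870 — 6 statements merged into one kernel-verified Lean document; each statement's English description precedes it below -/
import Mathlib

section
/- Let α_u, α_t, a_C, b_C, Δc, L, d, t_f be real numbers with α_u > 0 and α_t > 0 satisfying the reduced optimality conditions (i) a_C·t_f + b_C = 0, (ii) −b_C² + α_u·α_t + a_C·Δc = 0, and (iii) −(2/3)·a_C·t_f³ + Δc·t_f = α_u·(L + d). Then the quartic relation 4·α_u·α_t·t_f⁴ − 3·Δc²·t_f² + 12·α_u·Δc·(L + d)·t_f − 9·α_u²·(L + d)² = 0 holds. Moreover, if in addition a_C < 0 and t_f > 0, then α_u·(L + d) − Δc·t_f > 0. -/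
/-- From the reduced optimality conditions (terminal-control,
transversality, terminal safe-distance) one derives the quartic relation in the
terminal time `t_f`; moreover, if `a_C < 0` and `t_f > 0`, then
`α_u·(L + d) − Δc·t_f > 0`. -/
theorem stmt0 (α_u α_t a_C b_C Δc L d t_f : ℝ)
    (hαu : α_u > 0) (hαt : α_t > 0)
    (h1 : a_C * t_f + b_C = 0)
    (h2 : -b_C ^ 2 + α_u * α_t + a_C * Δc = 0)
    (h3 : -(2 / 3) * a_C * t_f ^ 3 + Δc * t_f = α_u * (L + d)) :
    4 * α_u * α_t * t_f ^ 4 - 3 * Δc ^ 2 * t_f ^ 2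
      + 12 * α_u * Δc * (L + d) * t_f - 9 * α_u ^ 2 * (L + d) ^ 2 = 0
    ∧ (a_C < 0 → t_f > 0 → α_u * (L + d) - Δc * t_f > 0) := by
  obtain rfl : b_C = -(a_C * t_f) := by linarith
  constructor
  · have hu : α_u * α_t = a_C ^ 2 * t_f ^ 2 - a_C * Δc := by linear_combination h2
    calc
      _ = 4 * (α_u * α_t) * t_f ^ 4 - 3 * Δc ^ 2 * t_f ^ 2
          + 12 * Δc * t_f * (α_u * (L + d)) - 9 * (α_u * (L + d)) ^ 2 := by ring
      _ = 0 := by rw [hu, ← h3]; ring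
  · intro ha ht
    have : 0 < -a_C * t_f ^ 3 := mul_pos (neg_pos.mpr ha) (pow_pos ht 3)
    linarith
end

section
/- Let α_u > 0, α_t > 0 and Δc, L, d, t_f be real numbers with t_f > 0, L + d > 0, α_u·(L + d) − Δc·t_f > 0, and suppose the quartic relation 4·α_u·α_t·t_f⁴ − 3·Δc²·t_f² + 12·α_u·Δc·(L + d)·t_f − 9·α_u²·(L + d)² = 0 holds. Then 16·α_u·α_t·t_f³ + 6·Δc·(2·α_u·(L + d) − Δc·t_f) > 0. -/
/-- Positivity of the denominator of `dt_f/dd` under the quartic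
relation and the sign conditions. -/
theorem stmt1 (α_u α_t Δc L d t_f : ℝ)
    (hαu : α_u > 0) (hαt : α_t > 0)
    (htf : t_f > 0) (hLd : L + d > 0)
    (hsign : α_u * (L + d) - Δc * t_f > 0)
    (hquartic : 4 * α_u * α_t * t_f ^ 4 - 3 * Δc ^ 2 * t_f ^ 2
      + 12 * α_u * Δc * (L + d) * t_f - 9 * α_u ^ 2 * (L + d) ^ 2 = 0) :
    16 * α_u * α_t * t_f ^ 3 + 6 * Δc * (2 * α_u * (L + d) - Δc * t_f) > 0 := by
  have ha : 0 < α_u * (L + d) := mul_pos hαu hLd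
  have hprod : 0 < (α_u * (L + d) - Δc * t_f) * (5 * (α_u * (L + d)) - Δc * t_f) :=
    mul_pos hsign (by linarith)
  have hmul : 0 < t_f *
      (16 * α_u * α_t * t_f ^ 3 + 6 * Δc * (2 * α_u * (L + d) - Δc * t_f)) := by
    linear_combination 6 * hprod + 6 * pow_pos ha 2 - 4 * hquartic
  exact pos_of_mul_pos_right hmul htf.le
end

section
/- (Monotonicity of the terminal time, Lemma 5.) Let α_u > 0, α_t > 0 and Δc, L be real numbers, let d₀ be a real number, and let T : ℝ → ℝ be differentiable at d₀ with derivative T′. Suppose that for every d in some open neighborhood of d₀ the quartic relation 4·α_u·α_t·T(d)⁴ − 3·Δc²·T(d)² + 12·α_u·Δc·(L + d)·T(d) − 9·α_u²·(L + d)² = 0 holds, and that T(d₀) > 0, L + d₀ > 0, and α_u·(L + d₀) − Δc·T(d₀) > 0. Then T′ > 0; that is, the terminal time is strictly increasing with respect to the initial relative distance d at d₀. -/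
open Filter Topology

/-- Lemma 5 of the paper: the terminal time `T(d)` defined
implicitly by the quartic relation is strictly increasing in the initial
relative distance `d` at `d₀`. -/
theorem stmt4 (α_u α_t Δc L d₀ T' : ℝ) (T : ℝ → ℝ)
    (hαu : α_u > 0) (hαt : α_t > 0)
    (hT : HasDerivAt T T' d₀)
    (hquartic : ∀ᶠ d in 𝓝 d₀,
      4 * α_u * α_t * (T d) ^ 4 - 3 * Δc ^ 2 * (T d) ^ 2
        + 12 * α_u * Δc * (L + d) * (T d) - 9 * α_u ^ 2 * (L + d) ^ 2 = 0)
    (htf : T d₀ > 0) (hLd : L + d₀ > 0)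
    (hsign : α_u * (L + d₀) - Δc * T d₀ > 0) :
    T' > 0 := by
  have hs : HasDerivAt (fun d : ℝ => L + d) 1 d₀ := (hasDerivAt_id d₀).const_add L
  have hpoly := ((((hT.pow 4).const_mul (4 * α_u * α_t)).sub
    ((hT.pow 2).const_mul (3 * Δc ^ 2))).add
    ((hs.const_mul (12 * α_u * Δc)).mul hT)).sub ((hs.pow 2).const_mul (9 * α_u ^ 2))
  have hzero := hpoly.unique ((hasDerivAt_const d₀ (0 : ℝ)).congr_of_eventuallyEq hquartic)
  have hq := hquartic.self_of_nhds
  norm_num at hzero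
  have hy : 0 < α_u * (L + d₀) := mul_pos hαu hLd
  have hcoef : 0 < (α_u * (L + d₀) - Δc * T d₀) * (5 * (α_u * (L + d₀)) - Δc * T d₀)
      + (α_u * (L + d₀)) ^ 2 :=
    add_pos (mul_pos hsign (by linarith)) (pow_pos hy 2)
  have hrhs : 0 < α_u * T d₀ * (3 * (α_u * (L + d₀)) - 2 * (Δc * T d₀)) :=
    mul_pos (mul_pos hαu htf) (by linarith)
  have hkey : ((α_u * (L + d₀) - Δc * T d₀) * (5 * (α_u * (L + d₀)) - Δc * T d₀)
      + (α_u * (L + d₀)) ^ 2) * T'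
      = α_u * T d₀ * (3 * (α_u * (L + d₀)) - 2 * (Δc * T d₀)) := by
    linear_combination (T d₀ / 6) * hzero - (2 / 3) * T' * hq
  exact pos_of_mul_pos_right (hkey ▸ hrhs) hcoef.le
end

section
/- Let α_u > 0, α_t > 0 and Δc, L, d, t_f be real numbers with Δc < 0, t_f > 0, L + d > 0, satisfying the quartic relation 4·α_u·α_t·t_f⁴ − 3·Δc²·t_f² + 12·α_u·Δc·(L + d)·t_f − 9·α_u²·(L + d)² = 0. Then N := 216·α_u³·α_t·(L+d)³ − 360·α_u³·α_t·Δc·t_f·(L+d)² + 180·α_u²·α_t·Δc²·t_f²·(L+d) − 36·α_u·α_t·Δc³·t_f³ + 24·α_u²·α_t·Δc²·t_f²·(L+d) + 32·α_u²·α_t²·Δc·t_f⁵ > 0. -/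
/-- Positivity of the numerator `N` of the cost derivative
`dJ/dd` in the case `Δc < 0`. -/
theorem stmt7 (α_u α_t Δc L d t_f : ℝ)
    (hαu : α_u > 0) (hαt : α_t > 0) (hΔc : Δc < 0)
    (htf : t_f > 0) (hLd : L + d > 0)
    (hquartic : 4 * α_u * α_t * t_f ^ 4 - 3 * Δc ^ 2 * t_f ^ 2
      + 12 * α_u * Δc * (L + d) * t_f - 9 * α_u ^ 2 * (L + d) ^ 2 = 0) :
    216 * α_u ^ 3 * α_t * (L + d) ^ 3
      - 360 * α_u ^ 3 * α_t * Δc * t_f * (L + d) ^ 2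
      + 180 * α_u ^ 2 * α_t * Δc ^ 2 * t_f ^ 2 * (L + d)
      - 36 * α_u * α_t * Δc ^ 3 * t_f ^ 3
      + 24 * α_u ^ 2 * α_t * Δc ^ 2 * t_f ^ 2 * (L + d)
      + 32 * α_u ^ 2 * α_t ^ 2 * Δc * t_f ^ 5 > 0 := by
  have hm : 0 < -Δc := neg_pos.mpr hΔc
  have hpos : 0 < α_t * (216 * α_u ^ 3 * (L + d) ^ 3
      + 288 * α_u ^ 3 * (-Δc) * t_f * (L + d) ^ 2
      + 108 * α_u ^ 2 * (-Δc) ^ 2 * t_f ^ 2 * (L + d)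
      + 12 * α_u * (-Δc) ^ 3 * t_f ^ 3) := by
    generalize -Δc = m at hm ⊢
    generalize L + d = x at hLd ⊢
    positivity
  linear_combination hpos - 8 * α_u * α_t * Δc * t_f * hquartic
end

section
/- (Theorem 2: cost monotonicity.) Let α_u > 0, α_t > 0 and Δc, L be real numbers, let d₀ be a real number, and let T : ℝ → ℝ be differentiable at d₀ with T(d₀) > 0, L + d₀ > 0, and α_u·(L + d₀) − Δc·T(d₀) > 0. Suppose that for every d in some open neighborhood of d₀ the quartic relation 4·α_u·α_t·T(d)⁴ − 3·Δc²·T(d)² + 12·α_u·Δc·(L + d)·T(d) − 9·α_u²·(L + d)² = 0 holds. Define J(d) := −2·α_u·α_t·T(d)·(L + d) / (3·α_u·(L + d) − Δc·T(d)) + 2·α_t·T(d). Then J is differentiable at d₀ with strictly positive derivative; that is, the optimal cost is strictly increasing with respect to the initial relative distance d at d₀. -/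
open Filter Topology

/-- Theorem 2 of the paper: the optimal cost
`J(d) = −2·α_u·α_t·T(d)·(L+d)/(3·α_u·(L+d) − Δc·T(d)) + 2·α_t·T(d)` is
strictly increasing with respect to the initial relative distance `d` at `d₀`. -/
theorem stmt8 (α_u α_t Δc L d₀ : ℝ) (T : ℝ → ℝ)
    (hαu : α_u > 0) (hαt : α_t > 0)
    (hT : DifferentiableAt ℝ T d₀)
    (htf : T d₀ > 0) (hLd : L + d₀ > 0)
    (hsign : α_u * (L + d₀) - Δc * T d₀ > 0)
    (hquartic : ∀ᶠ d in 𝓝 d₀,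
      4 * α_u * α_t * (T d) ^ 4 - 3 * Δc ^ 2 * (T d) ^ 2
        + 12 * α_u * Δc * (L + d) * (T d) - 9 * α_u ^ 2 * (L + d) ^ 2 = 0) :
    ∃ J' : ℝ, HasDerivAt (fun d : ℝ =>
      -(2 * α_u * α_t * T d * (L + d)) / (3 * α_u * (L + d) - Δc * T d)
        + 2 * α_t * T d) J' d₀ ∧ J' > 0 := by
  obtain ⟨p, hp⟩ : ∃ p, HasDerivAt T p d₀ := ⟨_, hT.hasDerivAt⟩
  have hs : HasDerivAt (fun d : ℝ => L + d) 1 d₀ := (hasDerivAt_id d₀).const_add L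
  have hD : 0 < 3 * α_u * (L + d₀) - Δc * T d₀ := by
    have : 0 < α_u * (L + d₀) := mul_pos hαu hLd
    linarith
  have hrel := hquartic.self_of_nhds
  -- implicit differentiation of the quartic relation
  have hderiv : 16 * α_u * α_t * T d₀ ^ 3 * p - 6 * Δc ^ 2 * T d₀ * p
      + 12 * α_u * Δc * (T d₀ + (L + d₀) * p) - 18 * α_u ^ 2 * (L + d₀) = 0 := by
    have h := ((((hp.pow 4).const_mul (4 * α_u * α_t)).sub
      ((hp.pow 2).const_mul (3 * Δc ^ 2))).add
      ((hs.const_mul (12 * α_u * Δc)).mul hp)).sub ((hs.pow 2).const_mul (9 * α_u ^ 2))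
    have hzero := h.unique ((hasDerivAt_const d₀ (0 : ℝ)).congr_of_eventuallyEq hquartic)
    norm_num at hzero
    linarith
  have hJ := ((((hp.const_mul (2 * α_u * α_t)).mul hs).neg).div
    ((hs.const_mul (3 * α_u)).sub (hp.const_mul Δc)) hD.ne').add (hp.const_mul (2 * α_t))
  refine ⟨2 * α_u * α_t * T d₀ / (3 * α_u * (L + d₀) - Δc * T d₀), ?_, by positivity⟩
  -- the terms in `p` cancel against the differentiated relation
  have hp_eq : p * (6 * (α_u * (L + d₀)) ^ 2 - 6 * (α_u * (L + d₀)) * (Δc * T d₀)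
      + (Δc * T d₀) ^ 2) = α_u * T d₀ * (3 * (α_u * (L + d₀)) - 2 * (Δc * T d₀)) := by
    linear_combination (T d₀ / 6) * hderiv - (2 * p / 3) * hrel
  refine hJ.congr_deriv ?_
  simp only [Pi.mul_apply, Pi.neg_apply, Pi.sub_apply]
  rw [div_add' _ _ _ (pow_ne_zero 2 hD.ne'), div_eq_div_iff (pow_ne_zero 2 hD.ne') hD.ne']
  linear_combination (2 * α_t * (3 * α_u * (L + d₀) - Δc * T d₀)) * hp_eq
end

section
/- Let α_u > 0, α_t > 0 and a_C, b_C, Δc, L, d, t_f be real numbers with t_f > 0 satisfying (i) a_C·t_f + b_C = 0, (ii) −b_C² + α_u·α_t + a_C·Δc = 0, and (iii) −(2/3)·a_C·t_f³ + Δc·t_f = α_u·(L + d). Set a_1 := −a_C, b_1 := −b_C, u_1(t) := (a_1·t + b_1)/α_u and u_C(t) := (a_C·t + b_C)/α_u. Then ∫₀^{t_f} [ (α_u/2)·(u_1(t)² + u_C(t)²) + α_t ] dt = a_C·(L + d) + 2·α_t·t_f. -/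
/-- Closed form of the integral component `J^int_{C,1}` of the
total cost under the unconstrained optimal controls
`u_1(t) = (a_1·t + b_1)/α_u`, `u_C(t) = (a_C·t + b_C)/α_u` with
`a_1 = −a_C`, `b_1 = −b_C`. -/
theorem stmt9 (α_u α_t a_C b_C Δc L d t_f : ℝ)
    (hαu : α_u > 0) (hαt : α_t > 0) (htf : t_f > 0)
    (h1 : a_C * t_f + b_C = 0)
    (h2 : -b_C ^ 2 + α_u * α_t + a_C * Δc = 0)
    (h3 : -(2 / 3) * a_C * t_f ^ 3 + Δc * t_f = α_u * (L + d)) :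
    ∫ t in (0 : ℝ)..t_f,
        (α_u / 2 * ((((-a_C) * t + (-b_C)) / α_u) ^ 2
          + ((a_C * t + b_C) / α_u) ^ 2) + α_t)
      = a_C * (L + d) + 2 * α_t * t_f := by
  obtain rfl : b_C = -(a_C * t_f) := by linarith
  have hne : α_u ≠ 0 := hαu.ne'
  have hderiv : ∀ t ∈ Set.uIcc (0 : ℝ) t_f,
      HasDerivAt (fun t => a_C ^ 2 / (3 * α_u) * (t - t_f) ^ 3 + α_t * t)
        (α_u / 2 * ((((-a_C) * t + (-(-(a_C * t_f)))) / α_u) ^ 2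
          + ((a_C * t + -(a_C * t_f)) / α_u) ^ 2) + α_t) t := by
    intro t _
    have h := ((((hasDerivAt_id' t).sub_const t_f).pow 3).const_mul
      (a_C ^ 2 / (3 * α_u))).add ((hasDerivAt_id' t).const_mul α_t)
    refine h.congr_deriv ?_
    push_cast
    field_simp
    ring
  rw [intervalIntegral.integral_eq_sub_of_hasDerivAt hderiv
    (Continuous.intervalIntegrable (by fun_prop) _ _)]
  have hLd : L + d = (-(2 / 3) * a_C * t_f ^ 3 + Δc * t_f) / α_u := by
    rw [h3, mul_div_cancel_left₀ _ hne]
  rw [hLd]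
  field_simp
  linear_combination (-3 * t_f) * h2
end
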